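/- arXiv:2203.14798 — 2 statements merged into one kernel-verified Lean document; each statement's English description precedes it below -/
import Mathlib

section
/- Let T be a minimum spanning tree of the complete weighted graph on (V, w), let 0 < α ≤ 1 and 0 < β < 1 be constants, and let E* be a set of pairs of vertices such that w(cov(E*)) ≤ β·MST(w) and such that for every pair (u,v) of distinct vertices, w(cov({(u,v)}) ∖ cov(E*)) ≤ w(u,v)/α. Then TSP(w) ≥ 2α(1 − β)·MST(w). -/
open scoped Classical

variable {V : Type*}

/-- `w` is a metric on `V`: symmetric, zero on the diagonal, positive on pairs of distinct
points, and satisfying the triangle inequality. -/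
structure IsMetric (w : V → V → ℝ) : Prop where
  symm : ∀ x y, w x y = w y x
  self : ∀ x, w x x = 0
  pos : ∀ x y, x ≠ y → 0 < w x y
  triangle : ∀ x y z, w x z ≤ w x y + w y z

/-- The weight of an unordered pair of vertices (for symmetric `w` this is just `w`). -/
noncomputable def sym2Weight (w : V → V → ℝ) : Sym2 V → ℝ :=
  Sym2.lift ⟨fun a b => (w a b + w b a) / 2, fun a b => by ring⟩

/-- The total weight of a set of unordered pairs of vertices. -/
noncomputable def setWeight (w : V → V → ℝ) (S : Set (Sym2 V)) : ℝ :=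
  ∑ᶠ e ∈ S, sym2Weight w e

/-- `MST(w)`: the minimum total weight of a spanning tree of the complete graph on `V`. -/
noncomputable def MSTcost (V : Type*) [Fintype V] (w : V → V → ℝ) : ℝ :=
  sInf { x | ∃ T : SimpleGraph V, T.IsTree ∧ x = setWeight w T.edgeSet }

/-- The cost of the tour visiting the points of `V` in the cyclic order given by `f`. -/
noncomputable def tourCost (V : Type*) [Fintype V] (w : V → V → ℝ)
    (f : Fin (Fintype.card V) → V) : ℝ :=
  ∑ i : Fin (Fintype.card V),
    w (f i) (f ⟨((i : ℕ) + 1) % Fintype.card V, Nat.mod_lt _ i.pos⟩)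

/-- `TSP(w)`: the minimum cost over all cyclic orderings of the points of `V`. -/
noncomputable def TSPcost (V : Type*) [Fintype V] (w : V → V → ℝ) : ℝ :=
  sInf { x | ∃ f : Fin (Fintype.card V) ≃ V, x = tourCost V w ⇑f }

/-- The pair `f` is covered by the pair `e`: `f` lies on a path in `T` between the two
endpoints of `e` (in a tree, this path is unique). -/
def covers (T : SimpleGraph V) (e f : Sym2 V) : Prop :=
  ∃ (u v : V) (p : T.Walk u v), e = s(u, v) ∧ p.IsPath ∧ f ∈ p.edges

/-- `cov(E')`: the set of edges of `T` covered by at least one pair in `E'`. -/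
def cov (T : SimpleGraph V) (E' : Set (Sym2 V)) : Set (Sym2 V) :=
  { f | f ∈ T.edgeSet ∧ ∃ e ∈ E', covers T e f }

theorem Fin.forall_of_forall_succ_mod {n : ℕ} {Q : Fin n → Prop}
    (h : ∀ i : Fin n, Q i → Q ⟨((i : ℕ) + 1) % n, Nat.mod_lt _ i.pos⟩)
    {i : Fin n} (hi : Q i) (j : Fin n) : Q j := by
  have key : ∀ k : ℕ, Q ⟨((i : ℕ) + k) % n, Nat.mod_lt _ i.pos⟩ := by
    intro k
    induction k with
    | zero => simpa [Nat.mod_eq_of_lt i.isLt] using hi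
    | succ k ih => simpa [Nat.add_assoc] using h _ ih
  have hj : ((i : ℕ) + (n - i + j)) % n = j := by
    rw [show (i : ℕ) + (n - i + j) = j + n by omega, Nat.add_mod_right,
      Nat.mod_eq_of_lt j.isLt]
  simpa only [hj] using key (n - i + j)

theorem Fin.exists_and_not_succ_mod {n : ℕ} {Q : Fin n → Prop} {i j : Fin n}
    (hi : Q i) (hj : ¬ Q j) :
    ∃ k : Fin n, Q k ∧ ¬ Q ⟨((k : ℕ) + 1) % n, Nat.mod_lt _ k.pos⟩ := by
  by_contra! h
  exact hj (Fin.forall_of_forall_succ_mod h hi j)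

theorem sym2Weight_nonneg {V : Type*} {w : V → V → ℝ} (hw : IsMetric w) (e : Sym2 V) :
    0 ≤ sym2Weight w e := by
  have h : ∀ x y, 0 ≤ w x y := fun x y => by
    by_cases hxy : x = y
    · rw [hxy, hw.self]
    · exact (hw.pos x y hxy).le
  induction e with
  | _ a b =>
    have hab := h a b
    have hba := h b a
    simp only [sym2Weight, Sym2.lift_mk]
    positivity

theorem setWeight_eq_sum {V : Type*} [Fintype V] (w : V → V → ℝ) (S : Set (Sym2 V)) :
    setWeight w S = ∑ e : Sym2 V, S.indicator (sym2Weight w) e := by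
  rw [setWeight, finsum_mem_def, finsum_eq_sum_of_fintype]

theorem setWeight_diff {V : Type*} [Fintype V] (w : V → V → ℝ) {S R : Set (Sym2 V)}
    (h : S ⊆ R) : setWeight w (R \ S) = setWeight w R - setWeight w S := by
  simp only [setWeight_eq_sum, ← Finset.sum_sub_distrib, Set.indicator_sdiff h, Pi.sub_apply]

/-- A pair separated by the removal of a tree edge covers that edge. -/
theorem covers_of_reachable_deleteEdges {V : Type*} {T : SimpleGraph V} (hT : T.IsTree)
    {e : Sym2 V} {a x y : V} (hx : (T.deleteEdges {e}).Reachable a x)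
    (hy : ¬ (T.deleteEdges {e}).Reachable a y) : covers T s(x, y) e := by
  obtain ⟨p, hp⟩ := (hT.connected x y).exists_isPath
  refine ⟨x, y, p, rfl, hp, ?_⟩
  by_contra he
  exact hy (hx.trans ⟨p.toDeleteEdge e he⟩)

/-- A cyclic tour through all vertices covers every tree edge at least twice. -/
theorem exists_ne_covers_of_tour {V : Type*} {n : ℕ} {T : SimpleGraph V}
    (hT : T.IsTree) (f : Fin n ≃ V) {e : Sym2 V} (he : e ∈ T.edgeSet) :
    ∃ i j : Fin n, i ≠ j ∧
      covers T s(f i, f ⟨((i : ℕ) + 1) % n, Nat.mod_lt _ i.pos⟩) e ∧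
      covers T s(f j, f ⟨((j : ℕ) + 1) % n, Nat.mod_lt _ j.pos⟩) e := by
  induction e with
  | _ a b =>
    have hb : ¬ (T.deleteEdges {s(a, b)}).Reachable a b :=
      SimpleGraph.isBridge_iff.mp (SimpleGraph.isAcyclic_iff_forall_isBridge.mp
        hT.isAcyclic he)
    let Q : Fin n → Prop := fun i => (T.deleteEdges {s(a, b)}).Reachable a (f i)
    have hQa : Q (f.symm a) := by simp [Q]
    have hQb : ¬ Q (f.symm b) := by simpa [Q] using hb
    obtain ⟨i, hi, hi'⟩ := Fin.exists_and_not_succ_mod hQa hQb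
    obtain ⟨j, hj, hj'⟩ :=
      Fin.exists_and_not_succ_mod (Q := fun k => ¬ Q k) hQb (not_not.mpr hQa)
    refine ⟨i, j, ?_, covers_of_reachable_deleteEdges hT hi hi', ?_⟩
    · rintro rfl
      exact hj hi
    · rw [Sym2.eq_swap]
      exact covers_of_reachable_deleteEdges hT (not_not.mp hj') hj

/-- The edges of `T` outside `C` are paid for twice by the pairs of a cyclic tour. -/
theorem two_mul_setWeight_diff_le_sum {V : Type*} [Fintype V] {n : ℕ} {w : V → V → ℝ}
    (hw : IsMetric w) {T : SimpleGraph V} (hT : T.IsTree) (f : Fin n ≃ V) (C : Set (Sym2 V)) :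
    2 * setWeight w (T.edgeSet \ C) ≤ ∑ i : Fin n,
      setWeight w (cov T {s(f i, f ⟨((i : ℕ) + 1) % n, Nat.mod_lt _ i.pos⟩)} \ C) := by
  simp only [setWeight_eq_sum]
  rw [Finset.sum_comm, Finset.mul_sum]
  refine Finset.sum_le_sum fun e _ => ?_
  have hnonneg : ∀ S : Set (Sym2 V), 0 ≤ S.indicator (sym2Weight w) e := fun S =>
    Set.indicator_nonneg (fun e _ => sym2Weight_nonneg hw e) e
  by_cases he : e ∈ T.edgeSet \ C
  · obtain ⟨i, j, hij, hi, hj⟩ := exists_ne_covers_of_tour hT f he.1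
    have hmem : ∀ p : Sym2 V, covers T p e → e ∈ cov T {p} \ C := fun p hp =>
      ⟨⟨he.1, p, rfl, hp⟩, he.2⟩
    calc 2 * (T.edgeSet \ C).indicator (sym2Weight w) e
        = sym2Weight w e + sym2Weight w e := by rw [Set.indicator_of_mem he, two_mul]
      _ = ∑ k ∈ {i, j}, (cov T {s(f k, f ⟨((k : ℕ) + 1) % n, Nat.mod_lt _ k.pos⟩)} \
            C).indicator (sym2Weight w) e := by
          rw [Finset.sum_pair hij, Set.indicator_of_mem (hmem _ hi),
            Set.indicator_of_mem (hmem _ hj)]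
      _ ≤ _ := Finset.sum_le_sum_of_subset_of_nonneg (Finset.subset_univ _)
          fun k _ _ => hnonneg _
  · rw [Set.indicator_of_notMem he, mul_zero]
    exact Finset.sum_nonneg fun k _ => hnonneg _

/-- Let `T` be a minimum spanning tree of the complete weighted graph on
`(V, w)`, let `0 < α ≤ 1` and `0 < β < 1`, and let `E*` be a set of pairs of vertices such
that `w(cov(E*)) ≤ β·MST(w)` and such that for every pair `(u,v)` of distinct vertices,
`w(cov({(u,v)}) ∖ cov(E*)) ≤ w(u,v)/α`. Then `TSP(w) ≥ 2α(1 − β)·MST(w)`. -/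
theorem tsp_lower_of_small_cover
    {V : Type*} [Fintype V] (hn : 2 ≤ Fintype.card V)
    (w : V → V → ℝ) (hw : IsMetric w)
    (T : SimpleGraph V) (hT : T.IsTree)
    (hTmst : setWeight w T.edgeSet = MSTcost V w)
    (α β : ℝ) (hα0 : 0 < α) (hα1 : α ≤ 1) (hβ0 : 0 < β) (hβ1 : β < 1)
    (Estar : Set (Sym2 V))
    (h1 : setWeight w (cov T Estar) ≤ β * MSTcost V w)
    (h2 : ∀ u v : V, u ≠ v →
      setWeight w (cov T {s(u, v)} \ cov T Estar) ≤ w u v / α) :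
    2 * α * (1 - β) * MSTcost V w ≤ TSPcost V w := by
  refine le_csInf ⟨_, (Fintype.equivFin V).symm, rfl⟩ ?_
  rintro _ ⟨f, rfl⟩
  have hdiff := setWeight_diff w (S := cov T Estar) (R := T.edgeSet) fun e he => he.1
  have htwice := two_mul_setWeight_diff_le_sum hw hT f (cov T Estar)
  have hsum : ∑ i, setWeight w (cov T {s(f i, f ⟨((i : ℕ) + 1) % Fintype.card V,
      Nat.mod_lt _ i.pos⟩)} \ cov T Estar) ≤ tourCost V w f / α := by
    rw [tourCost, Finset.sum_div]
    refine Finset.sum_le_sum fun i _ => h2 _ _ fun h => ?_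
    have hi := congrArg Fin.val (f.injective h)
    rcases Nat.lt_or_ge ((i : ℕ) + 1) (Fintype.card V) with hlt | hge
    · simp [Nat.mod_eq_of_lt hlt] at hi
    · have hlast : (i : ℕ) + 1 = Fintype.card V := by omega
      simp only [hlast, Nat.mod_self] at hi
      omega
  have hle : 2 * (1 - β) * MSTcost V w ≤ tourCost V w f / α := by
    rw [hTmst] at hdiff
    linarith
  rw [le_div_iff₀ hα0] at hle
  linarith
end

section
/- Let T be a minimum spanning tree of the complete weighted graph on (V, w), let V_1 be the set of vertices of odd degree in T, and let M be a perfect matching on V_1 of minimum total weight w(M) = ∑_{(u,v) ∈ M} w(u,v). Then TSP(w) ≥ 2·w(M). -/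
open scoped Classical

variable {V : Type*}

/-- `M` is a perfect matching on the vertex set `S`: a partition of `S` into unordered
pairs (of distinct vertices). -/
def IsPerfectMatchingOn (S : Set V) (M : Set (Sym2 V)) : Prop :=
  (∀ e ∈ M, ¬ e.IsDiag) ∧ (∀ e ∈ M, ∀ x ∈ e, x ∈ S) ∧
    (∀ x ∈ S, ∃! e, e ∈ M ∧ x ∈ e)

theorem IsMetric.nonneg {w : V → V → ℝ} (hw : IsMetric w) (x y : V) : 0 ≤ w x y := by
  by_cases h : x = y
  · rw [h, hw.self]
  · exact (hw.pos x y h).le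

theorem IsMetric.sym2Weight_mk {w : V → V → ℝ} (hw : IsMetric w) (x y : V) :
    sym2Weight w s(x, y) = w x y := by
  simp only [sym2Weight, Sym2.lift_mk, hw.symm y x]
  ring

/-- The cost of the path from `a` to `b` through the points of the list, in order. -/
def pathCost (w : V → V → ℝ) : V → List V → V → ℝ
  | a, [], b => w a b
  | a, x :: l, b => w a x + pathCost w x l b

/-- The cost of the closed tour through the points of the list, in order. -/
def cycleCost (w : V → V → ℝ) : List V → ℝ
  | [] => 0
  | a :: l => pathCost w a l a

/-- The disjoint pairs of consecutive entries of a list, starting from its head. -/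
def consecutivePairs : List V → List (Sym2 V)
  | a :: b :: l => s(a, b) :: consecutivePairs l
  | _ => []

section pathCost

variable {w : V → V → ℝ}

theorem IsMetric.pathCost_le_add_left (hw : IsMetric w) (a x : V) (l : List V) (b : V) :
    pathCost w a l b ≤ w a x + pathCost w x l b := by
  cases l with
  | nil => exact hw.triangle a x b
  | cons y l =>
    simp only [pathCost]
    linarith [hw.triangle a x y]

theorem IsMetric.pathCost_le_add_right (hw : IsMetric w) (a : V) (l : List V) (x b : V) :
    pathCost w a l b ≤ pathCost w a l x + w x b := by
  induction l generalizing a with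
  | nil => exact hw.triangle a x b
  | cons y l ih =>
    simp only [pathCost]
    linarith [ih y]

theorem IsMetric.pathCost_le_of_sublist (hw : IsMetric w) {l₁ l₂ : List V}
    (h : l₁.Sublist l₂) (a b : V) : pathCost w a l₁ b ≤ pathCost w a l₂ b := by
  induction h generalizing a with
  | slnil => exact le_rfl
  | cons x _ ih => exact (hw.pathCost_le_add_left a x _ b).trans (add_le_add le_rfl (ih x))
  | cons_cons x _ ih => exact add_le_add le_rfl (ih x)

theorem IsMetric.cycleCost_le_of_sublist (hw : IsMetric w) {l₁ l₂ : List V}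
    (h : l₁.Sublist l₂) : cycleCost w l₁ ≤ cycleCost w l₂ := by
  induction h with
  | slnil => exact le_rfl
  | @cons l₁ l₂ x _ ih =>
    refine ih.trans ?_
    cases l₂ with
    | nil => exact hw.nonneg x x
    | cons y t =>
      simp only [cycleCost, pathCost]
      linarith [hw.pathCost_le_add_right y t x y]
  | cons_cons x h _ => exact hw.pathCost_le_of_sublist h x x

theorem pathCost_map_range (g : ℕ → V) (m : ℕ) (b : V) :
    pathCost w (g 0) ((List.range m).map fun i => g (i + 1)) b =
      ∑ i ∈ Finset.range m, w (g i) (g (i + 1)) + w (g m) b := by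
  induction m generalizing g with
  | zero => simp [pathCost]
  | succ m ih =>
    rw [List.range_succ_eq_map, Finset.sum_range_succ']
    have := ih fun i => g (i + 1)
    simp only [List.map_cons, List.map_map, pathCost, Function.comp_def,
      Nat.succ_eq_add_one, zero_add] at this ⊢
    rw [this]
    ring

theorem cycleCost_map_range (g : ℕ → V) (n : ℕ) (hg : g n = g 0) :
    cycleCost w ((List.range n).map g) = ∑ i ∈ Finset.range n, w (g i) (g (i + 1)) := by
  cases n with
  | zero => simp [cycleCost]
  | succ m =>
    have := pathCost_map_range (w := w) g m (g 0)
    rw [List.range_succ_eq_map, Finset.sum_range_succ, hg]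
    simpa [cycleCost, Function.comp_def] using this

theorem IsMetric.pathCost_eq_sum_consecutivePairs (hw : IsMetric w) (a : V) (l : List V)
    (b : V) :
    pathCost w a l b = ((consecutivePairs (a :: (l ++ [b]))).map (sym2Weight w)).sum +
      ((consecutivePairs (l ++ [b])).map (sym2Weight w)).sum := by
  induction l generalizing a with
  | nil => simp [pathCost, consecutivePairs, hw.sym2Weight_mk]
  | cons x l ih =>
    simp only [pathCost, ih x, List.cons_append, consecutivePairs, List.map_cons,
      List.sum_cons, hw.sym2Weight_mk]
    ring

end pathCost

section consecutivePairs

theorem consecutivePairs_append_singleton (b : V) :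
    ∀ l : List V, Even l.length → consecutivePairs (l ++ [b]) = consecutivePairs l
  | [], _ => rfl
  | [_], h => by simp at h
  | x :: y :: l, h => by
    have hl : Even l.length := by
      simpa [Nat.even_add_one] using h
    simp [consecutivePairs, consecutivePairs_append_singleton b l hl]

theorem mem_of_mem_consecutivePairs {e : Sym2 V} {x : V} (hx : x ∈ e) :
    ∀ {l : List V}, e ∈ consecutivePairs l → x ∈ l
  | [], h => by simp [consecutivePairs] at h
  | [_], h => by simp [consecutivePairs] at h
  | a :: b :: l, h => by
    rcases List.mem_cons.1 h with rfl | h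
    · rcases Sym2.mem_iff.1 hx with rfl | rfl <;> simp
    · exact List.mem_cons_of_mem _ (List.mem_cons_of_mem _ (mem_of_mem_consecutivePairs hx h))

theorem nodup_consecutivePairs :
    ∀ {l : List V}, l.Nodup → (consecutivePairs l).Nodup
  | [], _ => List.nodup_nil
  | [_], _ => List.nodup_nil
  | a :: b :: l, h => by
    simp only [List.nodup_cons, List.mem_cons, not_or] at h
    exact List.nodup_cons.2
      ⟨fun he => h.1.2 (mem_of_mem_consecutivePairs (Sym2.mem_mk_left a b) he),
        nodup_consecutivePairs h.2.2⟩

theorem isPerfectMatchingOn_consecutivePairs :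
    ∀ {l : List V}, l.Nodup → Even l.length →
      IsPerfectMatchingOn {x | x ∈ l} {e | e ∈ consecutivePairs l}
  | [], _, _ => by simp [IsPerfectMatchingOn, consecutivePairs]
  | [_], _, h => by simp at h
  | a :: b :: l, h, he => by
    have hl : Even l.length := by
      simpa [Nat.even_add_one] using he
    simp only [List.nodup_cons, List.mem_cons, not_or] at h
    obtain ⟨h₁, -, h₃⟩ := isPerfectMatchingOn_consecutivePairs h.2.2 hl
    refine ⟨?_, fun e he x hx => mem_of_mem_consecutivePairs hx he, ?_⟩
    · intro e he
      rcases List.mem_cons.1 he with rfl | he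
      · simpa using h.1.1
      · exact h₁ e he
    · have hnew : ∀ x, x ∈ s(a, b) → x ∉ l := by
        intro x hx
        rcases Sym2.mem_iff.1 hx with rfl | rfl
        exacts [h.1.2, h.2.1]
      have hmem : ∀ x, x ∈ s(a, b) →
          ∃! e, e ∈ {e | e ∈ consecutivePairs (a :: b :: l)} ∧ x ∈ e := by
        refine fun x hx => ⟨s(a, b), ⟨List.mem_cons_self, hx⟩, fun e he => ?_⟩
        rcases List.mem_cons.1 he.1 with rfl | h'
        · rfl
        · exact absurd (mem_of_mem_consecutivePairs he.2 h') (hnew x hx)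
      intro x hx
      rcases List.mem_cons.1 hx with rfl | hx
      · exact hmem _ (Sym2.mem_mk_left _ _)
      rcases List.mem_cons.1 hx with rfl | hx
      · exact hmem _ (Sym2.mem_mk_right _ _)
      obtain ⟨e, ⟨he, hxe⟩, huniq⟩ := h₃ x hx
      refine ⟨e, ⟨List.mem_cons_of_mem _ he, hxe⟩, fun e' he' => ?_⟩
      rcases List.mem_cons.1 he'.1 with rfl | h'
      · exact absurd hx (hnew x he'.2)
      · exact huniq e' ⟨h', he'.2⟩

theorem setWeight_mem_list (w : V → V → ℝ) {l : List (Sym2 V)} (hl : l.Nodup) :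
    setWeight w {e | e ∈ l} = (l.map (sym2Weight w)).sum := by
  rw [setWeight, ← List.coe_toFinset, finsum_mem_coe_finset, List.sum_toFinset _ hl]

end consecutivePairs

/-- A closed tour through an even number of distinct points decomposes into two perfect
matchings on these points, so it costs at least twice any lower bound for such matchings. -/
theorem IsMetric.two_mul_le_cycleCost {w : V → V → ℝ} (hw : IsMetric w)
    {l : List V} (hl : l.Nodup) (heven : Even l.length) {c : ℝ}
    (hc : ∀ M, IsPerfectMatchingOn {x | x ∈ l} M → c ≤ setWeight w M) :
    2 * c ≤ cycleCost w l := by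
  cases l with
  | nil =>
    have := hc _ (isPerfectMatchingOn_consecutivePairs hl heven)
    rw [setWeight_mem_list w (nodup_consecutivePairs hl)] at this
    simp only [consecutivePairs, List.map_nil, List.sum_nil] at this
    simp only [cycleCost]
    linarith
  | cons x t =>
    have hperm : (t ++ [x]).Perm (x :: t) := List.perm_append_singleton x t
    have hl' : (t ++ [x]).Nodup := hperm.nodup_iff.2 hl
    have h₁ := hc _ (isPerfectMatchingOn_consecutivePairs hl heven)
    have h₂ := isPerfectMatchingOn_consecutivePairs hl' (by rwa [hperm.length_eq])
    simp only [hperm.mem_iff] at h₂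
    replace h₂ := hc _ h₂
    rw [setWeight_mem_list w (nodup_consecutivePairs hl)] at h₁
    rw [setWeight_mem_list w (nodup_consecutivePairs hl')] at h₂
    rw [cycleCost, hw.pathCost_eq_sum_consecutivePairs, ← List.cons_append,
      consecutivePairs_append_singleton x _ heven]
    linarith

/-- The cost of a tour is the cycle cost of a list enumerating all the points. -/
theorem exists_list_cycleCost_eq_tourCost [Fintype V] (w : V → V → ℝ)
    (f : Fin (Fintype.card V) ≃ V) :
    ∃ l : List V, l.Nodup ∧ (∀ x, x ∈ l) ∧ cycleCost w l = tourCost V w f := by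
  rcases Nat.eq_zero_or_pos (Fintype.card V) with h0 | hpos
  · have : IsEmpty V := Fintype.card_eq_zero_iff.1 h0
    have : IsEmpty (Fin (Fintype.card V)) := f.isEmpty
    exact ⟨[], List.nodup_nil, isEmptyElim, by simp [cycleCost, tourCost]⟩
  let g : ℕ → V := fun i => f ⟨i % Fintype.card V, Nat.mod_lt _ hpos⟩
  refine ⟨(List.range (Fintype.card V)).map g, ?_, fun x => ?_, ?_⟩
  · refine List.Nodup.map_on (fun i hi j hj hij => ?_) List.nodup_range
    simpa [g, Nat.mod_eq_of_lt (List.mem_range.1 hi), Nat.mod_eq_of_lt (List.mem_range.1 hj)]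
      using hij
  · refine List.mem_map.2 ⟨f.symm x, List.mem_range.2 (f.symm x).isLt, ?_⟩
    simp [g, Nat.mod_eq_of_lt (f.symm x).isLt]
  · rw [cycleCost_map_range g _ (by simp [g]), Finset.sum_range, tourCost]
    refine Finset.sum_congr rfl fun i _ => ?_
    simp [g, Nat.mod_eq_of_lt i.isLt]

theorem SimpleGraph.even_card_odd_ncard_neighborSet [Fintype V] (G : SimpleGraph V) :
    Even (Finset.univ.filter fun v => Odd (G.neighborSet v).ncard).card := by
  convert G.even_card_odd_degree_vertices using 4 with v
  rw [← G.card_neighborSet_eq_degree, Set.ncard_eq_toFinset_card', Set.toFinset_card]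

/-- Let `T` be a minimum spanning tree of the complete weighted graph on
`(V, w)`, `V₁` the set of odd-degree vertices of `T`, and `M` a minimum-weight perfect
matching on `V₁`. Then `TSP(w) ≥ 2·w(M)`. -/
theorem tsp_ge_two_min_matching
    {V : Type*} [Fintype V] (hn : 2 ≤ Fintype.card V)
    (w : V → V → ℝ) (hw : IsMetric w)
    (T : SimpleGraph V) (hT : T.IsTree)
    (hTmst : setWeight w T.edgeSet = MSTcost V w)
    (M : Set (Sym2 V))
    (hM : IsPerfectMatchingOn {v : V | Odd ((T.neighborSet v).ncard)} M)
    (hMmin : ∀ M' : Set (Sym2 V),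
      IsPerfectMatchingOn {v : V | Odd ((T.neighborSet v).ncard)} M' →
        setWeight w M ≤ setWeight w M') :
    2 * setWeight w M ≤ TSPcost V w := by
  refine le_csInf ⟨_, (Fintype.equivFin V).symm, rfl⟩ ?_
  rintro _ ⟨f, rfl⟩
  obtain ⟨l, hl, hmem, hcost⟩ := exists_list_cycleCost_eq_tourCost w f
  rw [← hcost]
  let p : V → Bool := fun v => decide (Odd (T.neighborSet v).ncard)
  refine le_trans ?_ (hw.cycleCost_le_of_sublist (List.filter_sublist (p := p) (l := l)))
  have hset : {x | x ∈ l.filter p} = {v : V | Odd ((T.neighborSet v).ncard)} := by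
    ext x
    simp [p, hmem]
  refine hw.two_mul_le_cycleCost (hl.filter p) ?_ fun M' hM' => hMmin M' (hset ▸ hM')
  rw [← List.toFinset_card_of_nodup (hl.filter p)]
  convert T.even_card_odd_ncard_neighborSet using 2
  ext x
  simp [p, hmem]
end
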